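/- Let B₁ ⊆ B₂ ⊆ A be integral domains such that B₁ is inert in A and the transcendence degrees satisfy trdeg(A/B₁) = trdeg(A/B₂) < ∞. Then B₁ = B₂. -/

import Mathlib

/-- If `B₁ ⊆ B₂ ⊆ A` are integral domains with `B₁` inert in `A` and
`trdeg(A/B₁) = trdeg(A/B₂) < ∞` (witnessed by finite transcendence bases indexed
by a common finite type), then `B₁ = B₂`. -/
theorem stmt_14 {A : Type*} [CommRing A] [IsDomain A] (B₁ B₂ : Subalgebra ℤ A)
    (hle : B₁ ≤ B₂)
    (hinert : ∀ f g : A, f ≠ 0 → g ≠ 0 → f * g ∈ B₁ → f ∈ B₁ ∧ g ∈ B₁)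
    (ι : Type) [Finite ι] (x y : ι → A)
    (hx : IsTranscendenceBasis B₁ x) (hy : IsTranscendenceBasis B₂ y) :
    B₁ = B₂ := by
  refine le_antisymm hle fun b hb ↦ ?_
  obtain rfl | hb0 := eq_or_ne b 0
  · exact zero_mem B₁
  let _ : Algebra B₁ B₂ := (Subalgebra.inclusion hle).toAlgebra
  have : IsScalarTower B₁ B₂ A := .of_algebraMap_eq fun _ ↦ rfl
  have : FaithfulSMul B₁ B₂ :=
    (faithfulSMul_iff_algebraMap_injective B₁ B₂).mpr (Subalgebra.inclusion_injective hle)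
  have hxy : Algebra.trdeg B₁ A = Algebra.trdeg B₂ A :=
    Cardinal.lift_injective
      (hx.lift_cardinalMk_eq_trdeg.symm.trans hy.lift_cardinalMk_eq_trdeg)
  have hfin : Algebra.trdeg B₂ A < Cardinal.aleph0 := by
    rw [← Cardinal.lift_lt_aleph0, ← hy.lift_cardinalMk_eq_trdeg, Cardinal.lift_lt_aleph0]
    exact Cardinal.lt_aleph0_of_finite ι
  have hzero : Algebra.trdeg B₁ B₂ = 0 := by
    have h : Algebra.trdeg B₁ B₂ + Algebra.trdeg B₂ A ≤ 0 + Algebra.trdeg B₂ A := by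
      rw [zero_add]
      exact trdeg_add_le.trans_eq hxy
    exact le_zero_iff.mp ((Cardinal.add_le_add_iff_of_lt_aleph0 hfin).mp h)
  have := trdeg_eq_zero_iff.mp hzero
  have hb_alg : IsAlgebraic B₁ b :=
    (Algebra.IsAlgebraic.isAlgebraic (R := B₁) (⟨b, hb⟩ : B₂)).algebraMap (A := A)
  obtain ⟨r, hr, c, hc⟩ := hb_alg.exists_nonzero_dvd (mem_nonZeroDivisors_of_ne_zero hb0)
  have hbc : b * c = (r : A) := hc.symm
  have hc0 : c ≠ 0 := by
    rintro rfl
    exact hr (Subtype.ext (by simpa using hbc.symm))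
  exact (hinert b c hb0 hc0 (hbc ▸ r.2)).1
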